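/- arXiv:1908.09211 — 3 statements merged into one kernel-verified Lean document; each statement's English description precedes it below -/
import Mathlib

section
/- Let X be a measurable space, c : X × X → ℝ a nonnegative measurable cost function, and p, q, r probability measures on X. Let f, g : X → ℝ be measurable functions, integrable with respect to both p and q, satisfying f(x) − g(y) ≤ c(x,y) for all x, y, such that dp = exp(f − κ[f]) dr and dq = exp(g − κ[g]) dr, where κ[h] := ln ∫ e^{h} dr. If the pair (f,g) attains the value of the dual optimal transport problem and this value equals the Kantorovich value K_c[p,q], i.e. ∫ f dp − ∫ g dq = K_c[p,q], then D[p,q] = K_c[p,q] − (κ[f] − κ[g]) − ∫ g d(p − q). -/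
open MeasureTheory
open scoped ENNReal

/-- Kullback-Leibler divergence `D[μ,ν] = ∫ ln(dμ/dν) dμ` (as a real number; under the
hypotheses of the theorem below all divergences appearing are finite). -/
noncomputable def KLdiv {Ω : Type*} [MeasurableSpace Ω] (μ ν : Measure Ω) : ℝ :=
  ∫ x, Real.log (μ.rnDeriv ν x).toReal ∂μ

/-- Cumulant (normalizing constant) `κ[h] := ln ∫ e^h dr`. -/
noncomputable def kappa {X : Type*} [MeasurableSpace X] (r : Measure X) (h : X → ℝ) : ℝ :=
  Real.log (∫ x, Real.exp (h x) ∂r)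

/-- Kantorovich value `K_c[p,q] := inf { ∫ c dw : π_X w = q, π_Y w = p }`. -/
noncomputable def Kval {X : Type*} [MeasurableSpace X]
    (c : X × X → ℝ) (q p : Measure X) : EReal :=
  sInf {v : EReal | ∃ w : Measure (X × X), IsProbabilityMeasure w ∧
    w.map Prod.fst = q ∧ w.map Prod.snd = p ∧
    v = ((∫⁻ z, ENNReal.ofReal (c z) ∂w : ℝ≥0∞) : EReal)}

/-- If `p` and `q` have densities `e^u` and `e^v` with respect to `r`, then `p` has density
`e^(u - v)` with respect to `q`. -/
theorem withDensity_exp_sub {X : Type*} [MeasurableSpace X] (r : Measure X) {u v : X → ℝ}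
    (hu : Measurable u) (hv : Measurable v) :
    (r.withDensity (fun x => ENNReal.ofReal (Real.exp (v x)))).withDensity
        (fun x => ENNReal.ofReal (Real.exp (u x - v x)))
      = r.withDensity (fun x => ENNReal.ofReal (Real.exp (u x))) := by
  rw [← withDensity_mul r (by fun_prop) (by fun_prop)]
  congr 1
  ext x
  rw [Pi.mul_apply, ← ENNReal.ofReal_mul (Real.exp_nonneg _), ← Real.exp_add, add_sub_cancel]

/-- The Kullback-Leibler divergence of a measure with density `e^h` is the integral of `h`. -/
theorem KLdiv_eq_integral_of_withDensity_exp {X : Type*} [MeasurableSpace X] (p q : Measure X)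
    [SigmaFinite q] {h : X → ℝ} (hh : Measurable h)
    (hpq : q.withDensity (fun x => ENNReal.ofReal (Real.exp (h x))) = p) :
    KLdiv p q = ∫ x, h x ∂p := by
  subst hpq
  have hd : Measurable fun x => ENNReal.ofReal (Real.exp (h x)) := by fun_prop
  refine integral_congr_ae ?_
  filter_upwards [(withDensity_absolutelyContinuous q _).ae_le
    (Measure.rnDeriv_withDensity q hd)] with x hx
  rw [hx, ENNReal.toReal_ofReal (Real.exp_nonneg _), Real.log_exp]

/-- **Theorem 2 of the paper.** If the dual optimal pair `(f,g)` satisfies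
`f = ∇D[p,r]`, `g = ∇D[q,r]` (i.e. `dp = e^{f-κ[f]} dr` and `dq = e^{g-κ[g]} dr`) and
`∫ f dp - ∫ g dq = K_c[p,q]`, then
`D[p,q] = K_c[p,q] - (κ[f] - κ[g]) - ∫ g d(p - q)`. -/
theorem dual_otp_gives_kl_decomposition
    {X : Type*} [MeasurableSpace X]
    (c : X × X → ℝ) (hc : Measurable c) (hc0 : ∀ z, 0 ≤ c z)
    (p q r : Measure X)
    [IsProbabilityMeasure p] [IsProbabilityMeasure q] [IsProbabilityMeasure r]
    (f g : X → ℝ) (hf : Measurable f) (hg : Measurable g)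
    (hfp : Integrable f p) (hfq : Integrable f q)
    (hgp : Integrable g p) (hgq : Integrable g q)
    (hef : Integrable (fun x => Real.exp (f x)) r)
    (heg : Integrable (fun x => Real.exp (g x)) r)
    (hfg : ∀ x y, f x - g y ≤ c (x, y))
    (hp : p = r.withDensity (fun x => ENNReal.ofReal (Real.exp (f x - kappa r f))))
    (hq : q = r.withDensity (fun x => ENNReal.ofReal (Real.exp (g x - kappa r g))))
    (hdual : ((∫ x, f x ∂p - ∫ x, g x ∂q : ℝ) : EReal) = Kval c q p) :
    ((KLdiv p q : ℝ) : EReal)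
      = Kval c q p - ((kappa r f - kappa r g : ℝ) : EReal)
        - ((∫ x, g x ∂p - ∫ x, g x ∂q : ℝ) : EReal) := by
  have hKL : KLdiv p q = ∫ x, ((f x - kappa r f) - (g x - kappa r g)) ∂p := by
    refine KLdiv_eq_integral_of_withDensity_exp p q (by fun_prop) ?_
    conv_rhs => rw [hp]
    conv_lhs => rw [hq]
    exact withDensity_exp_sub r (hf.sub_const _) (hg.sub_const _)
  have hfκ : Integrable (fun x => f x - kappa r f) p := hfp.sub (integrable_const _)
  have hgκ : Integrable (fun x => g x - kappa r g) p := hgp.sub (integrable_const _)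
  rw [← hdual, hKL, integral_sub hfκ hgκ, integral_sub hfp (integrable_const _),
    integral_sub hgp (integrable_const _)]
  simp only [integral_const, probReal_univ, one_smul]
  rw [← EReal.coe_sub, ← EReal.coe_sub]
  congr 1
  ring
end

section
/- Law of cosines for the Kullback–Leibler divergence: let p, q, r be probability measures on a measurable space X with p ≪ r and q ≪ r and with D[p,r], D[r,q], and ∫ |ln(dq/dr)| d(p + r) finite. Then D[p,q] = D[p,r] + D[r,q] − ∫ ln(dq/dr) (dp − dr), i.e. D[p,q] = D[p,r] + D[r,q] − ∫ ln(dq/dr) dp + ∫ ln(dq/dr) dr. -/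
open MeasureTheory

/-- Chain rule for log-likelihood ratios: a common reference measure `ξ` can be used to compute
`llr μ ν`. -/
theorem llr_ae_eq_llr_sub_llr {Ω : Type*} [MeasurableSpace Ω] {μ ν ξ : Measure Ω}
    [SigmaFinite μ] [SigmaFinite ν] [SigmaFinite ξ] (hμξ : μ ≪ ξ) (hξν : ξ ≪ ν) :
    llr μ ν =ᵐ[μ] fun x => llr μ ξ x - llr ν ξ x := by
  have hμν : μ ≪ ν := hμξ.trans hξν
  filter_upwards [hμξ.ae_le (Measure.rnDeriv_mul_rnDeriv (κ := ξ) hμν),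
    Measure.rnDeriv_pos hμν, hμν.ae_le (Measure.rnDeriv_ne_top μ ν),
    hμξ.ae_le (Measure.rnDeriv_pos' hξν), hμξ.ae_le (Measure.rnDeriv_ne_top ν ξ)]
    with x h_mul h_pos h_top h_pos' h_top'
  rw [llr, llr, llr, ← h_mul, Pi.mul_apply, ENNReal.toReal_mul,
    Real.log_mul (ENNReal.toReal_ne_zero.2 ⟨h_pos.ne', h_top⟩)
      (ENNReal.toReal_ne_zero.2 ⟨h_pos'.ne', h_top'⟩), add_sub_cancel_right]

/-- **law of cosines for the KL-divergence.** For probability measures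
`p, q, r` with `p ≪ r`, `q ≪ r`, with `D[p,r]` and `D[r,q]` finite and `ln(dq/dr)`
integrable against both `p` and `r`,
`D[p,q] = D[p,r] + D[r,q] - ∫ ln(dq/dr) dp + ∫ ln(dq/dr) dr`. -/
theorem kl_law_of_cosines {X : Type*} [MeasurableSpace X]
    (p q r : Measure X)
    [IsProbabilityMeasure p] [IsProbabilityMeasure q] [IsProbabilityMeasure r]
    (hpr : p ≪ r) (hqr : q ≪ r)
    (hpr_fin : Integrable (fun x => Real.log (p.rnDeriv r x).toReal) p)
    (hrq : r ≪ q)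
    (hrq_fin : Integrable (fun x => Real.log (r.rnDeriv q x).toReal) r)
    (hqr_p : Integrable (fun x => Real.log (q.rnDeriv r x).toReal) p)
    (hqr_r : Integrable (fun x => Real.log (q.rnDeriv r x).toReal) r) :
    KLdiv p q = KLdiv p r + KLdiv r q
      - (∫ x, Real.log (q.rnDeriv r x).toReal ∂p
          - ∫ x, Real.log (q.rnDeriv r x).toReal ∂r) := by
  have h_left : ∫ x, llr p q x ∂p = ∫ x, llr p r x ∂p - ∫ x, llr q r x ∂p := by
    rw [← integral_sub (f := llr p r) (g := llr q r) hpr_fin hqr_p]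
    exact integral_congr_ae (llr_ae_eq_llr_sub_llr hpr hrq)
  have h_right : ∫ x, llr r q x ∂r = -∫ x, llr q r x ∂r := by
    rw [← integral_neg]
    refine integral_congr_ae ?_
    filter_upwards [neg_llr hrq] with x hx
    rw [← hx, Pi.neg_apply, neg_neg]
  simp only [KLdiv, ← llr_def]
  linarith
end

section
/- Derivative of the cumulant generating function along an exponential family: let r be a probability measure on a measurable space X and f : X → ℝ a bounded measurable function. Define κ(β) := ln ∫ e^{β f} dr and the probability measure p_β by dp_β = e^{β f − κ(β)} dr. Then for every β ∈ ℝ, κ is differentiable at β with κ′(β) = ∫ f dp_β. -/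
open MeasureTheory

/-- **Statement 11: derivative of the cumulant generating function along an exponential
family.** For a bounded measurable `f` and `κ(β) := ln ∫ e^{β f} dr`, the function `κ`
is differentiable at every `β` with `κ'(β) = ∫ f dp_β`, where
`dp_β = e^{β f - κ(β)} dr`. -/
theorem cumulant_hasDerivAt {X : Type*} [MeasurableSpace X]
    (r : Measure X) [IsProbabilityMeasure r]
    (f : X → ℝ) (hf : Measurable f) (M : ℝ) (hbd : ∀ x, |f x| ≤ M) (β : ℝ) :
    HasDerivAt (fun b : ℝ => Real.log (∫ x, Real.exp (b * f x) ∂r))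
      (∫ x, f x ∂(r.withDensity (fun x => ENNReal.ofReal
        (Real.exp (β * f x - Real.log (∫ y, Real.exp (β * f y) ∂r)))))) β := by
  have hexp (t : ℝ) : Integrable (fun x => Real.exp (t * f x)) r :=
    ProbabilityTheory.integrable_exp_mul_of_mem_Icc hf.aemeasurable
      (ae_of_all r fun x => abs_le.mp (hbd x))
  have hint : β ∈ interior (ProbabilityTheory.integrableExpSet f r) := by
    simp [hexp, ProbabilityTheory.integrableExpSet]
  have hpos : 0 < ∫ y, Real.exp (β * f y) ∂r := integral_exp_pos (hexp β)
  have hdensity : (fun x => ENNReal.ofReal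
      (Real.exp (β * f x - Real.log (∫ y, Real.exp (β * f y) ∂r)))) =
      fun x => ENNReal.ofReal (Real.exp (β * f x) / ∫ y, Real.exp (β * f y) ∂r) := by
    simp_rw [Real.exp_sub, Real.exp_log hpos]
  rw [hdensity]
  change HasDerivAt (ProbabilityTheory.cgf f r) (∫ x, f x ∂r.tilted (β * f ·)) β
  rw [ProbabilityTheory.integral_tilted_mul_self hint]
  exact (ProbabilityTheory.analyticAt_cgf hint).differentiableAt.hasDerivAt
end
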